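/- Let p be an odd prime, k a positive integer, and 0 ≤ j < k. Consider the set T_j of values c_{k+1}(R) taken over all subgroups R of GL₂(ℤ/p^{k+1}ℤ) with c_k(π(R)) = p^j. Then: if 2j < k − 1, T_j = {0, p^j}; if 2j = k − 1, T_j = {0, p^j, p^{j+1}}; and if k ≤ 2j (and j < k), T_j = {0, p^j, p^{j+1}, 2p^j}. -/

import Mathlib

open Matrix

abbrev GL2 (N : ℕ) := GL (Fin 2) (ZMod N)

/-- The Borel subgroup `B₀(N)` of upper-triangular matrices, as a set. -/
def B0 (N : ℕ) : Set (GL2 N) :=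
  {g | (g : Matrix (Fin 2) (Fin 2) (ZMod N)) 1 0 = 0}

/-- The number of `g` with `g R g⁻¹ ⊆ H`. -/
noncomputable def conjCount {N : ℕ} (H : Set (GL2 N)) (R : Subgroup (GL2 N)) : ℕ :=
  Nat.card {g : GL2 N | ∀ r ∈ R, g * r * g⁻¹ ∈ H}

/-- `S(H)`: the set of `m` with `#{g : gRg⁻¹ ⊆ H} = m * #H` for some subgroup `R`. -/
def Sset {N : ℕ} (H : Set (GL2 N)) : Set ℕ :=
  {m | ∃ R : Subgroup (GL2 N), conjCount H R = m * Nat.card H}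
/-- Reduction `GL₂(ℤ/p^{k+1}ℤ) →* GL₂(ℤ/p^kℤ)` induced by reduction of entries mod `p^k`. -/
def redGL (p k : ℕ) : GL2 (p ^ (k + 1)) →* GL2 (p ^ k) :=
  Units.map ((ZMod.castHom (pow_dvd_pow p (Nat.le_succ k)) (ZMod (p ^ k))).mapMatrix.toMonoidHom)

/-- The residue class of `a` modulo `p ^ s` has `p ^ (n - s)` members in `[0, p ^ n)`. -/
theorem ncard_residue_class {p n s : ℕ} (hp : p.Prime) (hs : s ≤ n) (a : ℤ) :
    {x : ℤ | (0 ≤ x ∧ x < (p : ℤ) ^ n) ∧ (p : ℤ) ^ s ∣ x - a}.ncard = p ^ (n - s) := by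
  have hpos : (0 : ℤ) < (p : ℤ) ^ s := by have := hp.pos; positivity
  have hset : {x : ℤ | (0 ≤ x ∧ x < (p : ℤ) ^ n) ∧ (p : ℤ) ^ s ∣ x - a} =
      (fun i : ℕ => a % (p : ℤ) ^ s + (p : ℤ) ^ s * i) '' Set.Iio (p ^ (n - s)) := by
    have hn : (p : ℤ) ^ n = (p : ℤ) ^ s * (p : ℤ) ^ (n - s) := by
      rw [← pow_add, Nat.add_sub_cancel' hs]
    have h0 := Int.emod_nonneg a hpos.ne'
    have h1 := Int.emod_lt_of_pos a hpos
    have h2 := Int.emod_add_mul_ediv a ((p : ℤ) ^ s)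
    ext x
    simp only [Set.mem_ofPred_eq, Set.mem_image, Set.mem_Iio]
    constructor
    · rintro ⟨⟨hx0, hxn⟩, hd⟩
      have hmod : x % (p : ℤ) ^ s = a % (p : ℤ) ^ s := (Int.emod_emod_of_dvd x dvd_rfl) ▸
        ((Int.emod_emod_of_dvd x dvd_rfl).trans (Int.ModEq.symm ((Int.modEq_iff_dvd).2 hd)))
      have h3 := Int.emod_add_mul_ediv x ((p : ℤ) ^ s)
      refine ⟨(x / (p : ℤ) ^ s).toNat, ?_, ?_⟩
      · have : x / (p : ℤ) ^ s < (p : ℤ) ^ (n - s) := by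
          apply Int.ediv_lt_of_lt_mul hpos
          rw [mul_comm]; rwa [← hn]
        have h4 : ((p ^ (n - s) : ℕ) : ℤ) = (p : ℤ) ^ (n - s) := by push_cast; rfl
        have h5 := Int.ediv_nonneg hx0 hpos.le
        omega
      · rw [Int.toNat_of_nonneg (Int.ediv_nonneg hx0 hpos.le), ← hmod]
        exact h3
    · rintro ⟨i, hi, rfl⟩
      have hi' : (i : ℤ) + 1 ≤ (p : ℤ) ^ (n - s) := by exact_mod_cast hi
      refine ⟨⟨by positivity, ?_⟩, ?_⟩
      · rw [hn]; nlinarith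
      · refine ⟨i - a / (p : ℤ) ^ s, ?_⟩
        linear_combination h2
  rw [hset, Set.ncard_image_of_injective, ← Finset.coe_range, Set.ncard_coe_finset,
    Finset.card_range]
  intro i j hij
  simpa [hp.ne_zero] using hij

/-- If `p ^ N` divides `y * z` and `p ^ (a + 1)` does not divide `y`, then `p ^ (N - a)`
divides `z`. -/
theorem pow_sub_dvd_of_pow_dvd_mul {p : ℕ} (hp : p.Prime) {N a : ℕ} {y z : ℤ}
    (h : (p : ℤ) ^ N ∣ y * z) (hy : ¬ (p : ℤ) ^ (a + 1) ∣ y) : (p : ℤ) ^ (N - a) ∣ z := by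
  have hp' : Prime (p : ℤ) := Nat.prime_iff_prime_int.1 hp
  induction a generalizing N y with
  | zero => exact hp'.pow_dvd_of_dvd_mul_left N (by simpa using hy) h
  | succ a ih =>
    by_cases hpy : (p : ℤ) ∣ y
    · obtain ⟨y, rfl⟩ := hpy
      cases N with
      | zero => simp
      | succ N =>
        rw [Nat.succ_sub_succ]
        refine ih (N := N) (y := y) ?_ fun hd => hy ?_
        · rw [pow_succ', mul_assoc] at h
          exact (mul_dvd_mul_iff_left hp'.ne_zero).1 h
        · rw [pow_succ']
          exact mul_dvd_mul_left _ hd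
    · exact (pow_dvd_pow _ (Nat.sub_le _ _)).trans (hp'.pow_dvd_of_dvd_mul_left N hpy h)

/-- The number of points of `ℙ¹(ℤ/pⁿ)` at which all binary quadratic forms
`b u² + δ u w - c w²` with `(b, δ, c) ∈ M` vanish. The points are listed as `(x : 1)`, and as
`(1 : w)` with `p ∣ w`. -/
noncomputable def lineCount (p n : ℕ) (M : Set (ℤ × ℤ × ℤ)) : ℕ :=
  {x : ℤ | (0 ≤ x ∧ x < (p : ℤ) ^ n) ∧
    ∀ t ∈ M, (p : ℤ) ^ n ∣ t.1 * x ^ 2 + t.2.1 * x - t.2.2}.ncard +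
  {w : ℤ | (0 ≤ w ∧ w < (p : ℤ) ^ n) ∧ (p : ℤ) ∣ w ∧
    ∀ t ∈ M, (p : ℤ) ^ n ∣ t.1 + t.2.1 * w - t.2.2 * w ^ 2}.ncard

theorem ncard_eq_of_iff_residue_class {p n s : ℕ} (hp : p.Prime) (hs : s ≤ n) (a : ℤ)
    {P : ℤ → Prop} (hP : ∀ x, P x ↔ (p : ℤ) ^ s ∣ x - a) :
    {x : ℤ | (0 ≤ x ∧ x < (p : ℤ) ^ n) ∧ P x}.ncard = p ^ (n - s) := by
  simp only [hP]
  exact ncard_residue_class hp hs a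

theorem ncard_eq_of_iff_two_residue_classes {p n s : ℕ} (hp : p.Prime) (hs : s ≤ n) {a b : ℤ}
    (hab : ¬ (p : ℤ) ^ s ∣ a - b) {P : ℤ → Prop}
    (hP : ∀ x, P x ↔ (p : ℤ) ^ s ∣ x - a ∨ (p : ℤ) ^ s ∣ x - b) :
    {x : ℤ | (0 ≤ x ∧ x < (p : ℤ) ^ n) ∧ P x}.ncard = 2 * p ^ (n - s) := by
  have hfin : ∀ Q : ℤ → Prop, {x : ℤ | (0 ≤ x ∧ x < (p : ℤ) ^ n) ∧ Q x}.Finite := fun Q =>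
    (Set.finite_Ico (0 : ℤ) ((p : ℤ) ^ n)).subset fun x hx => hx.1
  simp only [hP, and_or_left, Set.ofPred_or]
  rw [Set.ncard_union_eq _ (hfin _) (hfin _), ncard_residue_class hp hs,
    ncard_residue_class hp hs, two_mul]
  rw [Set.disjoint_left]
  rintro x ⟨-, hx⟩ ⟨-, hx'⟩
  refine hab ?_
  have := dvd_sub hx' hx
  rwa [show x - b - (x - a) = a - b by ring] at this

theorem pow_dvd_and_pow_dvd_iff (p a b : ℕ) (x : ℤ) :
    ((p : ℤ) ^ a ∣ x ∧ (p : ℤ) ^ b ∣ x) ↔ (p : ℤ) ^ max a b ∣ x - 0 := by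
  rw [sub_zero]
  refine ⟨fun h => ?_, fun h => ⟨(pow_dvd_pow _ (le_max_left _ _)).trans h,
    (pow_dvd_pow _ (le_max_right _ _)).trans h⟩⟩
  rcases max_cases a b with h' | h' <;> rw [h'.1]
  exacts [h.1, h.2]

/-- If `p ^ μ ∣ m` and `N ≤ 2 μ`, then `x (x + m) ≡ 0` modulo `p ^ N` means that `x` is divisible
by `p ^ ⌈N / 2⌉`. -/
theorem pow_dvd_mul_add_iff {p N μ : ℕ} (hp : p.Prime) {m : ℤ} (hm : (p : ℤ) ^ μ ∣ m)
    (hN : N ≤ 2 * μ) (x : ℤ) : (p : ℤ) ^ N ∣ x * (x + m) ↔ (p : ℤ) ^ ((N + 1) / 2) ∣ x := by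
  have hm' : (p : ℤ) ^ ((N + 1) / 2) ∣ m := (pow_dvd_pow _ (by omega)).trans hm
  constructor
  · intro h
    by_contra hx
    have hx' : ¬ (p : ℤ) ^ ((N + 1) / 2 - 1 + 1) ∣ x := fun h' => hx <| by
      by_cases h0 : (N + 1) / 2 = 0
      · simp [h0]
      · rwa [Nat.sub_add_cancel (by omega)] at h'
    have := pow_sub_dvd_of_pow_dvd_mul hp h hx'
    exact hx ((dvd_add_left hm').1 ((pow_dvd_pow _ (by omega)).trans this))
  · intro h
    have h2 := mul_dvd_mul h (dvd_add h hm')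
    rw [← pow_add] at h2
    exact (pow_dvd_pow _ (by omega)).trans h2

/-- If `p ^ μ` exactly divides `m` and `2 μ < N`, then `x (x + m) ≡ 0` modulo `p ^ N` means that
`x` is congruent to `0` or `-m` modulo `p ^ (N - μ)`. -/
theorem pow_dvd_mul_add_iff_or {p N μ : ℕ} (hp : p.Prime) {m : ℤ} (hm : (p : ℤ) ^ μ ∣ m)
    (hm' : ¬ (p : ℤ) ^ (μ + 1) ∣ m) (hN : 2 * μ < N) (x : ℤ) :
    (p : ℤ) ^ N ∣ x * (x + m) ↔ (p : ℤ) ^ (N - μ) ∣ x ∨ (p : ℤ) ^ (N - μ) ∣ x + m := by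
  have hmul : (p : ℤ) ^ N = (p : ℤ) ^ (N - μ) * (p : ℤ) ^ μ := by
    rw [← pow_add]; congr 1; omega
  constructor
  · intro h
    by_cases hx : (p : ℤ) ^ (μ + 1) ∣ x
    · left
      refine pow_sub_dvd_of_pow_dvd_mul hp (mul_comm x _ ▸ h) fun h' => hm' ?_
      exact (dvd_add_right hx).1 h'
    · exact Or.inr (pow_sub_dvd_of_pow_dvd_mul hp h hx)
  · rintro (h | h)
    · rw [hmul]
      exact mul_dvd_mul h (dvd_add ((pow_dvd_pow _ (by omega)).trans h) hm)
    · rw [hmul, mul_comm x]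
      refine mul_dvd_mul h ((dvd_add_left hm).1 ((pow_dvd_pow _ (by omega)).trans h))

theorem ncard_roots_of_le {p n N μ f : ℕ} (hp : p.Prime) {m : ℤ} (hm : (p : ℤ) ^ μ ∣ m)
    (hN : N ≤ 2 * μ) (hn : N ≤ n) :
    {x : ℤ | (0 ≤ x ∧ x < (p : ℤ) ^ n) ∧
      ((p : ℤ) ^ N ∣ x * (x + m) ∧ (p : ℤ) ^ (N - f) ∣ x)}.ncard =
    p ^ (n - max ((N + 1) / 2) (N - f)) :=
  ncard_eq_of_iff_residue_class hp (by omega) 0 fun x => by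
    rw [pow_dvd_mul_add_iff hp hm hN, pow_dvd_and_pow_dvd_iff]

theorem ncard_roots_of_lt_of_lt {p n N μ f : ℕ} (hp : p.Prime) {m : ℤ} (hm : (p : ℤ) ^ μ ∣ m)
    (hm' : ¬ (p : ℤ) ^ (μ + 1) ∣ m) (hN : 2 * μ < N) (hf : μ < N - f) (hn : N ≤ n) :
    {x : ℤ | (0 ≤ x ∧ x < (p : ℤ) ^ n) ∧
      ((p : ℤ) ^ N ∣ x * (x + m) ∧ (p : ℤ) ^ (N - f) ∣ x)}.ncard =
    p ^ (n - max (N - μ) (N - f)) :=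
  ncard_eq_of_iff_residue_class hp (by omega) 0 fun x => by
    rw [pow_dvd_mul_add_iff_or hp hm hm' hN, ← pow_dvd_and_pow_dvd_iff, or_and_right, or_iff_left]
    rintro ⟨h1, h2⟩
    exact hm' ((dvd_add_right ((pow_dvd_pow _ (by omega)).trans h2)).1
      ((pow_dvd_pow _ (by omega)).trans h1))

theorem ncard_roots_of_lt_of_le {p n N μ f : ℕ} (hp : p.Prime) {m : ℤ} (hm : (p : ℤ) ^ μ ∣ m)
    (hm' : ¬ (p : ℤ) ^ (μ + 1) ∣ m) (hN : 2 * μ < N) (hf : N - f ≤ μ) (hn : N ≤ n) :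
    {x : ℤ | (0 ≤ x ∧ x < (p : ℤ) ^ n) ∧
      ((p : ℤ) ^ N ∣ x * (x + m) ∧ (p : ℤ) ^ (N - f) ∣ x)}.ncard =
    2 * p ^ (n - (N - μ)) := by
  refine ncard_eq_of_iff_two_residue_classes hp (by omega) (a := 0) (b := -m) ?_ fun x => ?_
  · rw [zero_sub, neg_neg]
    exact fun h => hm' ((pow_dvd_pow _ (by omega)).trans h)
  · rw [pow_dvd_mul_add_iff_or hp hm hm' hN, sub_zero, sub_neg_eq_add, and_iff_left_of_imp]
    rintro (h | h)
    · exact (pow_dvd_pow _ (by omega)).trans h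
    · exact (dvd_add_left ((pow_dvd_pow _ hf).trans hm)).1 ((pow_dvd_pow _ (by omega)).trans h)

/-- The largest power of `p` with exponent at most `B` dividing all members of a family. -/
theorem exists_max_pow_dvd {ι : Type*} (p B d : ℕ) (hd : d ≤ B) (s : Set ι) (v : ι → ℤ)
    (hv : ∀ i ∈ s, (p : ℤ) ^ d ∣ v i) :
    ∃ f, d ≤ f ∧ f ≤ B ∧ (∀ i ∈ s, (p : ℤ) ^ f ∣ v i) ∧
      (f = B ∨ ∃ i ∈ s, ¬ (p : ℤ) ^ (f + 1) ∣ v i) := by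
  classical
  have hP : ∀ i ∈ s, (p : ℤ) ^ Nat.findGreatest (fun f => ∀ i ∈ s, (p : ℤ) ^ f ∣ v i) B ∣ v i :=
    Nat.findGreatest_spec (P := fun f => ∀ i ∈ s, (p : ℤ) ^ f ∣ v i) hd hv
  refine ⟨_, Nat.le_findGreatest hd hv, Nat.findGreatest_le B, hP, ?_⟩
  by_contra! h
  have hle := Nat.findGreatest_le (P := fun f => ∀ i ∈ s, (p : ℤ) ^ f ∣ v i) B
  exact absurd (Nat.le_findGreatest (P := fun f => ∀ i ∈ s, (p : ℤ) ^ f ∣ v i)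
    (show _ + 1 ≤ B by omega) h.2) (by omega)

/-- If `y` is `p ^ d` times a unit and `p ^ d ∣ z`, then `z` is a multiple of `y` modulo
`p ^ n`. -/
theorem exists_mul_congr {p d : ℕ} (hp : p.Prime) (n : ℕ) {y z : ℤ} (hy : (p : ℤ) ^ d ∣ y)
    (hy' : ¬ (p : ℤ) ^ (d + 1) ∣ y) (hz : (p : ℤ) ^ d ∣ z) :
    ∃ m : ℤ, (p : ℤ) ^ n ∣ z - y * m := by
  obtain ⟨y, rfl⟩ := hy
  obtain ⟨z, rfl⟩ := hz
  have hp' : Prime (p : ℤ) := Nat.prime_iff_prime_int.1 hp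
  have hco : IsCoprime y ((p : ℤ) ^ n) := by
    refine (IsCoprime.symm ?_).pow_right
    refine (Prime.coprime_iff_not_dvd hp').2 fun h => hy' ?_
    rw [pow_succ]
    exact mul_dvd_mul_left _ h
  obtain ⟨u, v, huv⟩ := hco
  refine ⟨u * z, p ^ d * (v * z), ?_⟩
  linear_combination (-(p : ℤ) ^ d * z) * huv

/-- Forms of the shape `b u² + δ u w` with a coefficient `b` of minimal valuation `d`: the common
zeros are the solutions of `x (x + m) ≡ 0`, `p ^ (n - d - f) x ≡ 0`. -/
theorem exists_lineCount_eq_ncard_roots {p d k : ℕ} (hp : p.Prime) (hd : d < k)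
    {M : Set (ℤ × ℤ × ℤ)} (hc : ∀ t ∈ M, t.2.2 = 0) (hb : ∀ t ∈ M, (p : ℤ) ^ d ∣ t.1)
    (hδ : ∀ t ∈ M, (p : ℤ) ^ d ∣ t.2.1) {t₀ : ℤ × ℤ × ℤ} (ht₀ : t₀ ∈ M)
    (hb₀ : ¬ (p : ℤ) ^ (d + 1) ∣ t₀.1) :
    ∃ (m : ℤ) (f : ℕ), ∀ n, d < n → n ≤ k + 1 → lineCount p n M =
      {x : ℤ | (0 ≤ x ∧ x < (p : ℤ) ^ n) ∧
        ((p : ℤ) ^ (n - d) ∣ x * (x + m) ∧ (p : ℤ) ^ (n - d - f) ∣ x)}.ncard := by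
  obtain ⟨m, hm⟩ := exists_mul_congr hp (k + 1) (hb t₀ ht₀) hb₀ (hδ t₀ ht₀)
  obtain ⟨f, hdf, hfB, hf, hf'⟩ := exists_max_pow_dvd p (k + 1) d (by omega) M
    (fun t => t.2.1 - t.1 * m) fun t ht => dvd_sub (hδ t ht) (dvd_mul_of_dvd_left (hb t ht) _)
  refine ⟨m, f - d, fun n hdn hnk => ?_⟩
  have hB : {w : ℤ | (0 ≤ w ∧ w < (p : ℤ) ^ n) ∧ (p : ℤ) ∣ w ∧
      ∀ t ∈ M, (p : ℤ) ^ n ∣ t.1 + t.2.1 * w - t.2.2 * w ^ 2} = ∅ := by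
    refine Set.eq_empty_of_forall_notMem ?_
    rintro w ⟨-, hw, h⟩
    have h0 := h t₀ ht₀
    rw [hc t₀ ht₀, zero_mul, sub_zero] at h0
    refine hb₀ ((dvd_add_left ?_).1 ((pow_dvd_pow _ hdn).trans h0))
    rw [pow_succ]
    exact mul_dvd_mul (hδ t₀ ht₀) hw
  have hsplit : (p : ℤ) ^ n = (p : ℤ) ^ d * (p : ℤ) ^ (n - d) := by
    rw [← pow_add]; congr 1; omega
  rw [lineCount, hB, Set.ncard_empty, add_zero]
  congr 1
  ext x
  refine and_congr_right fun _ => ⟨fun h => ?_, fun h t ht => ?_⟩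
  · have h1 : (p : ℤ) ^ (n - d) ∣ x * (x + m) := by
      refine pow_sub_dvd_of_pow_dvd_mul hp (y := t₀.1) ?_ hb₀
      have h0 := h t₀ ht₀
      rw [hc t₀ ht₀, sub_zero] at h0
      have h2 := dvd_sub h0 (((pow_dvd_pow _ hnk).trans hm).mul_right x)
      rwa [show t₀.1 * x ^ 2 + t₀.2.1 * x - (t₀.2.1 - t₀.1 * m) * x = t₀.1 * (x * (x + m)) by
        ring] at h2
    refine ⟨h1, ?_⟩
    rcases hf' with rfl | ⟨t, ht, hft⟩
    · rw [show n - d - (k + 1 - d) = 0 by omega, pow_zero]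
      exact one_dvd x
    · rw [show n - d - (f - d) = n - f by omega]
      refine pow_sub_dvd_of_pow_dvd_mul hp ?_ hft
      have h0 := h t ht
      rw [hc t ht, sub_zero] at h0
      have h2 := mul_dvd_mul (hb t ht) h1
      rw [← hsplit] at h2
      have h3 := dvd_sub h0 h2
      rwa [show t.1 * x ^ 2 + t.2.1 * x - t.1 * (x * (x + m)) = (t.2.1 - t.1 * m) * x by
        ring] at h3
  · have h2 := mul_dvd_mul (hb t ht) h.1
    have h3 := mul_dvd_mul (hf t ht) h.2
    rw [← hsplit] at h2
    rw [← pow_add] at h3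
    have h4 := dvd_add h2 ((pow_dvd_pow _ (by omega)).trans h3)
    rw [hc t ht, sub_zero]
    rwa [show t.1 * (x * (x + m)) + (t.2.1 - t.1 * m) * x = t.1 * x ^ 2 + t.2.1 * x by
      ring] at h4

/-- Forms of the shape `b u² + δ u w` with minimal valuation `d` attained by a coefficient `δ`
but by no coefficient `b`. -/
theorem lineCount_eq_or_eq {p d k : ℕ} (hp : p.Prime) (hd : d < k)
    {M : Set (ℤ × ℤ × ℤ)} (hc : ∀ t ∈ M, t.2.2 = 0) (hb : ∀ t ∈ M, (p : ℤ) ^ (d + 1) ∣ t.1)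
    (hδ : ∀ t ∈ M, (p : ℤ) ^ d ∣ t.2.1) {t₀ : ℤ × ℤ × ℤ} (ht₀ : t₀ ∈ M)
    (hδ₀ : ¬ (p : ℤ) ^ (d + 1) ∣ t₀.2.1) :
    ∃ a : ℤ, ∀ n, d < n → n ≤ k + 1 →
      ((∀ t ∈ M, (p : ℤ) ^ n ∣ t.1 + t.2.1 * a) ∧ lineCount p n M = 2 * p ^ d) ∨
      ((¬ ∀ t ∈ M, (p : ℤ) ^ n ∣ t.1 + t.2.1 * a) ∧ lineCount p n M = p ^ d) := by
  have hb' : ∀ t ∈ M, (p : ℤ) ^ d ∣ t.1 := fun t ht => (pow_dvd_pow _ d.le_succ).trans (hb t ht)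
  obtain ⟨a, ha⟩ := exists_mul_congr hp (k + 1) (hδ t₀ ht₀) hδ₀ ((hb' t₀ ht₀).neg_right)
  have ha' : (p : ℤ) ^ (k + 1) ∣ t₀.1 + t₀.2.1 * a := by
    have := ha.neg_right
    rwa [show -(-t₀.1 - t₀.2.1 * a) = t₀.1 + t₀.2.1 * a by ring] at this
  have hpa : (p : ℤ) ∣ a := by
    have h1 := (dvd_add_right (hb t₀ ht₀)).1 ((pow_dvd_pow _ (by omega)).trans ha')
    simpa using pow_sub_dvd_of_pow_dvd_mul hp h1 hδ₀
  refine ⟨a, fun n hdn hnk => ?_⟩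
  have hsplit : (p : ℤ) ^ n = (p : ℤ) ^ d * (p : ℤ) ^ (n - d) := by
    rw [← pow_add]; congr 1; omega
  have hA : {x : ℤ | (0 ≤ x ∧ x < (p : ℤ) ^ n) ∧
      ∀ t ∈ M, (p : ℤ) ^ n ∣ t.1 * x ^ 2 + t.2.1 * x - t.2.2}.ncard = p ^ d := by
    rw [ncard_eq_of_iff_residue_class hp (Nat.sub_le n d) 0, Nat.sub_sub_self hdn.le]
    intro x
    rw [sub_zero]
    refine ⟨fun h => ?_, fun h t ht => ?_⟩
    · have h0 := h t₀ ht₀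
      rw [hc t₀ ht₀, sub_zero, show t₀.1 * x ^ 2 + t₀.2.1 * x = (t₀.1 * x + t₀.2.1) * x by
        ring] at h0
      exact pow_sub_dvd_of_pow_dvd_mul hp h0 fun h' =>
        hδ₀ ((dvd_add_right ((hb t₀ ht₀).mul_right x)).1 h')
    · rw [hc t ht, sub_zero, show t.1 * x ^ 2 + t.2.1 * x = (t.1 * x + t.2.1) * x by ring, hsplit]
      exact mul_dvd_mul (dvd_add ((hb' t ht).mul_right x) (hδ t ht)) h
  have hw : ∀ w : ℤ, (∀ t ∈ M, (p : ℤ) ^ n ∣ t.1 + t.2.1 * w - t.2.2 * w ^ 2) →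
      (p : ℤ) ^ (n - d) ∣ w - a := fun w h => by
    refine pow_sub_dvd_of_pow_dvd_mul hp ?_ hδ₀
    have h0 := dvd_sub (h t₀ ht₀) ((pow_dvd_pow _ hnk).trans ha')
    rwa [hc t₀ ht₀, show t₀.1 + t₀.2.1 * w - 0 * w ^ 2 - (t₀.1 + t₀.2.1 * a) =
      t₀.2.1 * (w - a) by ring] at h0
  rw [lineCount, hA]
  by_cases hE : ∀ t ∈ M, (p : ℤ) ^ n ∣ t.1 + t.2.1 * a
  · refine Or.inl ⟨hE, ?_⟩
    rw [ncard_eq_of_iff_residue_class hp (Nat.sub_le n d) a, Nat.sub_sub_self hdn.le, two_mul]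
    refine fun w => ⟨fun h => hw w h.2, fun h => ⟨?_, fun t ht => ?_⟩⟩
    · have : (p : ℤ) ∣ w - a := (dvd_pow_self _ (by omega)).trans h
      exact (dvd_sub_left hpa).1 this
    · have h1 := mul_dvd_mul (hδ t ht) h
      rw [← hsplit] at h1
      have h2 := dvd_add (hE t ht) h1
      rwa [show t.1 + t.2.1 * a + t.2.1 * (w - a) = t.1 + t.2.1 * w - t.2.2 * w ^ 2 by
        rw [hc t ht]; ring] at h2
  · refine Or.inr ⟨hE, ?_⟩
    rw [Nat.add_eq_left, Set.ncard_eq_zero ((Set.finite_Ico (0 : ℤ) ((p : ℤ) ^ n)).subset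
      fun w hw => hw.1)]
    refine Set.eq_empty_of_forall_notMem ?_
    rintro w ⟨-, -, h⟩
    refine hE fun t ht => ?_
    have h1 := mul_dvd_mul (hδ t ht) (hw w h)
    rw [← hsplit] at h1
    have h2 := dvd_sub (h t ht) h1
    rwa [show t.1 + t.2.1 * w - t.2.2 * w ^ 2 - t.2.1 * (w - a) = t.1 + t.2.1 * a by
      rw [hc t ht]; ring] at h2

theorem two_mul_pow_ne_pow {p : ℕ} (hodd : Odd p) (a b : ℕ) : 2 * p ^ a ≠ p ^ b := fun h =>
  Nat.not_even_iff_odd.2 (hodd.pow (n := b)) (h ▸ even_two_mul _)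

theorem lineCount_succ_mem {p k j : ℕ} (hp : p.Prime) (hodd : Odd p) (hj : j < k)
    {M : Set (ℤ × ℤ × ℤ)} (hc : ∀ t ∈ M, t.2.2 = 0) (hM : lineCount p k M = p ^ j) :
    lineCount p (k + 1) M = p ^ j ∨
    (k ≤ 2 * j + 1 ∧ lineCount p (k + 1) M = p ^ (j + 1)) ∨
    (k ≤ 2 * j ∧ lineCount p (k + 1) M = 2 * p ^ j) := by
  obtain ⟨d, -, hdk, hd, hd'⟩ := exists_max_pow_dvd p k 0 (Nat.zero_le k) (M ×ˢ Set.univ)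
    (fun q : (ℤ × ℤ × ℤ) × Bool => if q.2 then q.1.1 else q.1.2.1) (by simp)
  have hb : ∀ t ∈ M, (p : ℤ) ^ d ∣ t.1 := fun t ht => by simpa using hd (t, true) (by simpa)
  have hδ : ∀ t ∈ M, (p : ℤ) ^ d ∣ t.2.1 := fun t ht => by simpa using hd (t, false) (by simpa)
  rcases hdk.eq_or_lt with rfl | hdk'
  · exfalso
    rw [lineCount, ncard_eq_of_iff_residue_class hp (Nat.zero_le d) 0,
      ncard_eq_of_iff_residue_class hp (s := 1) (by omega) 0] at hM
    · have h1 : p ^ j ≤ p ^ (d - 1) := Nat.pow_le_pow_right hp.pos (by omega)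
      have h2 : 0 < p ^ (d - 0) := pow_pos hp.pos _
      omega
    · intro w
      rw [pow_one, sub_zero, and_iff_left]
      intro t ht
      rw [hc t ht, zero_mul, sub_zero]
      exact dvd_add (hb t ht) ((hδ t ht).mul_right w)
    · intro x
      refine iff_of_true (fun t ht => ?_) (by simp)
      rw [hc t ht, sub_zero]
      exact dvd_add ((hb t ht).mul_right _) ((hδ t ht).mul_right x)
  replace hd' := hd'.resolve_left hdk'.ne
  by_cases hbd : ∃ t ∈ M, ¬ (p : ℤ) ^ (d + 1) ∣ t.1
  · obtain ⟨t₀, ht₀, hb₀⟩ := hbd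
    obtain ⟨m, f, hmf⟩ := exists_lineCount_eq_ncard_roots hp hdk' hc hb hδ ht₀ hb₀
    rw [hmf k hdk' (by omega)] at hM
    rw [hmf (k + 1) (by omega) le_rfl]
    have hinj := Nat.pow_right_injective hp.two_le
    obtain ⟨μ, -, -, hμ, hμ'⟩ := exists_max_pow_dvd p (k + 1) 0 (Nat.zero_le _)
      (Set.univ : Set Unit) (fun _ => m) (by simp)
    replace hμ : (p : ℤ) ^ μ ∣ m := hμ () trivial
    by_cases h1 : k + 1 - d ≤ 2 * μ
    · rw [ncard_roots_of_le hp hμ (by omega) (by omega)] at hM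
      rw [ncard_roots_of_le hp hμ (by omega) (by omega)]
      have := hinj hM
      have : k + 1 - max ((k + 1 - d + 1) / 2) (k + 1 - d - f) = j ∨
        k ≤ 2 * j + 1 ∧ k + 1 - max ((k + 1 - d + 1) / 2) (k + 1 - d - f) = j + 1 := by
        omega
      rcases this with h | ⟨h2, h⟩
      · rw [h]; exact Or.inl rfl
      · rw [h]; exact Or.inr (Or.inl ⟨h2, rfl⟩)
    have hm' : ¬ (p : ℤ) ^ (μ + 1) ∣ m := by
      rcases hμ' with h | ⟨-, -, h⟩
      · omega
      · exact h
    by_cases h2 : k - d ≤ 2 * μ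
    · rw [ncard_roots_of_le hp hμ (by omega) (by omega)] at hM
      have := hinj hM
      by_cases hf : μ < k + 1 - d - f
      · rw [ncard_roots_of_lt_of_lt hp hμ hm' (by omega) hf (by omega)]
        left; congr 1; omega
      · rw [ncard_roots_of_lt_of_le hp hμ hm' (by omega) (by omega) (by omega)]
        right; right
        refine ⟨by omega, ?_⟩
        congr 2; omega
    · by_cases hf : μ < k - d - f
      · rw [ncard_roots_of_lt_of_lt hp hμ hm' (by omega) hf (by omega)] at hM
        rw [ncard_roots_of_lt_of_lt hp hμ hm' (by omega) (by omega) (by omega)]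
        have := hinj hM
        left; congr 1; omega
      · rw [ncard_roots_of_lt_of_le hp hμ hm' (by omega) (by omega) (by omega)] at hM
        exact absurd hM (two_mul_pow_ne_pow hodd _ _)
  · push Not at hbd
    obtain ⟨⟨t₀, _ | _⟩, ht₀, hδ₀⟩ := hd'
    · obtain ⟨a, ha⟩ := lineCount_eq_or_eq hp hdk' hc hbd hδ (by simpa using ht₀)
        (by simpa using hδ₀)
      rcases ha k hdk' (by omega) with ⟨-, h⟩ | ⟨h, h'⟩
      · exact absurd (h.symm.trans hM) (two_mul_pow_ne_pow hodd _ _)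
      · rcases ha (k + 1) (by omega) le_rfl with ⟨h2, -⟩ | ⟨-, h2⟩
        · exact absurd (fun t ht => (pow_dvd_pow _ k.le_succ).trans (h2 t ht)) h
        · exact Or.inl (h2.trans (h'.symm.trans hM))
    · exact absurd (hbd t₀ (by simpa using ht₀)) (by simpa using hδ₀)

/-- The Borel subgroup `B₀(N)` as a subgroup. -/
def borelSubgroup (N : ℕ) : Subgroup (GL2 N) where
  carrier := B0 N
  one_mem' := by simp [B0]
  mul_mem' {a b} ha hb := by
    simp only [B0, Set.mem_ofPred_eq] at ha hb ⊢
    simp [Matrix.mul_apply, Fin.sum_univ_two, ha, hb]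
  inv_mem' {a} ha := by
    simp only [B0, Set.mem_ofPred_eq] at ha ⊢
    simp [Matrix.coe_units_inv, Matrix.inv_def, Matrix.adjugate_fin_two, ha]

theorem mem_borelSubgroup {N : ℕ} {g : GL2 N} :
    g ∈ borelSubgroup N ↔ (g : Matrix (Fin 2) (Fin 2) (ZMod N)) 1 0 = 0 := Iff.rfl

/-- A matrix with bottom row `(x, 1)`. -/
def lowerRep {N : ℕ} (x : ZMod N) : GL2 N where
  val := !![1, 0; x, 1]
  inv := !![1, 0; -x, 1]
  val_inv := by simp [Matrix.one_fin_two]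
  inv_val := by simp [Matrix.one_fin_two]

/-- A matrix with bottom row `(1, w)`. -/
def swapRep {N : ℕ} (w : ZMod N) : GL2 N where
  val := !![0, 1; 1, w]
  inv := !![-w, 1; 1, 0]
  val_inv := by simp [Matrix.one_fin_two]
  inv_val := by simp [Matrix.one_fin_two]

theorem lowerRep_conj_mem_borelSubgroup {N : ℕ} (x : ZMod N) (r : GL2 N) :
    lowerRep x * r * (lowerRep x)⁻¹ ∈ borelSubgroup N ↔
      r.val 0 1 * x ^ 2 + (r.val 1 1 - r.val 0 0) * x - r.val 1 0 = 0 := by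
  rw [mem_borelSubgroup, ← neg_eq_zero]
  simp only [lowerRep, Units.val_mul, Units.inv_mk, Matrix.mul_apply, Fin.sum_univ_two]
  simp only [Matrix.of_apply, Matrix.cons_val', Matrix.cons_val_zero, Matrix.cons_val_one,
    Matrix.cons_val_fin_one]
  ring_nf

theorem swapRep_conj_mem_borelSubgroup {N : ℕ} (w : ZMod N) (r : GL2 N) :
    swapRep w * r * (swapRep w)⁻¹ ∈ borelSubgroup N ↔
      r.val 0 1 + (r.val 1 1 - r.val 0 0) * w - r.val 1 0 * w ^ 2 = 0 := by
  rw [mem_borelSubgroup]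
  simp only [swapRep, Units.val_mul, Units.inv_mk, Matrix.mul_apply, Fin.sum_univ_two]
  simp only [Matrix.of_apply, Matrix.cons_val', Matrix.cons_val_zero, Matrix.cons_val_one,
    Matrix.cons_val_fin_one]
  ring_nf

/-- Representatives of the right cosets of the Borel subgroup when `ZMod N` is local. -/
def cosetRep {N : ℕ} : ZMod N ⊕ {w : ZMod N // ¬ IsUnit w} → GL2 N :=
  Sum.elim lowerRep fun w => swapRep w

theorem isUnit_apply_one_one_of_mem_borelSubgroup {N : ℕ} {b : GL2 N} (hb : b ∈ borelSubgroup N) :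
    IsUnit (b.val 1 1) := by
  have hdet : IsUnit b.val.det := (Matrix.isUnit_iff_isUnit_det _).1 b.isUnit
  rw [Matrix.det_fin_two, mem_borelSubgroup.1 hb, mul_zero, sub_zero] at hdet
  exact isUnit_of_mul_isUnit_right hdet

theorem bijective_mul_cosetRep (N : ℕ) [IsLocalRing (ZMod N)] :
    Function.Bijective fun q : borelSubgroup N × (ZMod N ⊕ {w : ZMod N // ¬ IsUnit w}) =>
      (q.1 : GL2 N) * cosetRep q.2 := by
  have hlow : ∀ (b : borelSubgroup N) (x : ZMod N),
      (b.1 * lowerRep x).val 1 0 = b.1.val 1 1 * x ∧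
      (b.1 * lowerRep x).val 1 1 = b.1.val 1 1 := fun b x => by
    have := mem_borelSubgroup.1 b.2
    simp [lowerRep, Matrix.mul_apply, Fin.sum_univ_two, this]
  have hswap : ∀ (b : borelSubgroup N) (w : ZMod N),
      (b.1 * swapRep w).val 1 0 = b.1.val 1 1 ∧
      (b.1 * swapRep w).val 1 1 = b.1.val 1 1 * w := fun b w => by
    have := mem_borelSubgroup.1 b.2
    simp [swapRep, Matrix.mul_apply, Fin.sum_univ_two, this]
  constructor
  · rintro ⟨b, l⟩ ⟨b', l'⟩ h
    have hu := isUnit_apply_one_one_of_mem_borelSubgroup b.2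
    have hu' := isUnit_apply_one_one_of_mem_borelSubgroup b'.2
    have hl : l = l' := by
      rcases l with x | ⟨w, hw⟩ <;> rcases l' with x' | ⟨w', hw'⟩ <;>
        simp only [cosetRep, Sum.elim_inl, Sum.elim_inr] at h
      · have h0 := hlow b x
        rw [h, (hlow b' x').1, (hlow b' x').2] at h0
        rw [← h0.2] at h0
        rw [hu'.mul_left_cancel h0.1]
      · have h0 := hlow b x
        rw [h, (hswap b' w').2] at h0
        rw [← h0.2] at hu
        exact absurd (isUnit_of_mul_isUnit_right hu) hw'
      · have h0 := hswap b w
        rw [h, (hlow b' x').2] at h0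
        rw [h0.2] at hu'
        exact absurd (isUnit_of_mul_isUnit_right hu') hw
      · have h0 := hswap b w
        rw [h, (hswap b' w').1, (hswap b' w').2] at h0
        rw [← h0.1] at h0
        congr 2
        exact (hu'.mul_left_cancel h0.2).symm
    subst hl
    rw [Prod.mk.injEq]
    exact ⟨Subtype.ext (mul_right_cancel h), rfl⟩
  · intro g
    suffices h : ∃ l, g * (cosetRep l)⁻¹ ∈ borelSubgroup N by
      obtain ⟨l, hl⟩ := h
      exact ⟨(⟨_, hl⟩, l), inv_mul_cancel_right _ _⟩
    by_cases hw : IsUnit (g.val 1 1)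
    · obtain ⟨v, hv⟩ := hw.exists_right_inv
      refine ⟨Sum.inl (g.val 1 0 * v), ?_⟩
      rw [mem_borelSubgroup]
      simp only [cosetRep, Sum.elim_inl, lowerRep, Units.val_mul, Units.inv_mk, Matrix.mul_apply,
        Fin.sum_univ_two]
      simp only [Matrix.of_apply, Matrix.cons_val', Matrix.cons_val_zero, Matrix.cons_val_one,
        Matrix.cons_val_fin_one]
      linear_combination (-g.val 1 0) * hv
    · have hu : IsUnit (g.val 1 0) := by
        have hdet : IsUnit g.val.det := (Matrix.isUnit_iff_isUnit_det _).1 g.isUnit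
        rw [Matrix.det_fin_two, sub_eq_add_neg] at hdet
        rcases IsLocalRing.isUnit_or_isUnit_of_isUnit_add hdet with h | h
        · exact absurd (isUnit_of_mul_isUnit_right h) hw
        · exact isUnit_of_mul_isUnit_right ((IsUnit.neg_iff _).1 h)
      obtain ⟨v, hv⟩ := hu.exists_right_inv
      refine ⟨Sum.inr ⟨g.val 1 1 * v, fun h => hw (isUnit_of_mul_isUnit_left h)⟩, ?_⟩
      rw [mem_borelSubgroup]
      simp only [cosetRep, Sum.elim_inr, swapRep, Units.val_mul, Units.inv_mk, Matrix.mul_apply,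
        Fin.sum_univ_two]
      simp only [Matrix.of_apply, Matrix.cons_val', Matrix.cons_val_zero, Matrix.cons_val_one,
        Matrix.cons_val_fin_one]
      linear_combination (-g.val 1 1) * hv

/-- The number of `g` conjugating the group generated by `S` into the Borel subgroup, counted by
cosets. -/
theorem conjCount_closure_eq_card_mul (N : ℕ) [NeZero N] [IsLocalRing (ZMod N)]
    (S : Set (GL2 N)) :
    conjCount (B0 N) (Subgroup.closure S) =
      (Nat.card {x : ZMod N // ∀ r ∈ S, lowerRep x * r * (lowerRep x)⁻¹ ∈ borelSubgroup N} +
        Nat.card {w : {w : ZMod N // ¬ IsUnit w} //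
          ∀ r ∈ S, swapRep w.1 * r * (swapRep w.1)⁻¹ ∈ borelSubgroup N}) * Nat.card (B0 N) := by
  have hgood : ∀ g : GL2 N, (∀ r ∈ Subgroup.closure S, g * r * g⁻¹ ∈ B0 N) ↔
      ∀ r ∈ S, g * r * g⁻¹ ∈ borelSubgroup N := fun g =>
    Subgroup.closure_le (K := (borelSubgroup N).comap (MulAut.conj g).toMonoidHom)
  let e := Equiv.ofBijective _ (bijective_mul_cosetRep N)
  have he : ∀ q : borelSubgroup N × (ZMod N ⊕ {w : ZMod N // ¬ IsUnit w}),
      (∀ r ∈ S, cosetRep q.2 * r * (cosetRep q.2)⁻¹ ∈ borelSubgroup N) ↔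
        ∀ r ∈ Subgroup.closure S, e q * r * (e q)⁻¹ ∈ B0 N := fun q => by
    rw [hgood]
    refine forall₂_congr fun r _ => ?_
    rw [show e q * r * (e q)⁻¹ = q.1 * (cosetRep q.2 * r * (cosetRep q.2)⁻¹) * (q.1 : GL2 N)⁻¹ by
      simp only [e, Equiv.ofBijective_apply]; group,
      Subgroup.mul_mem_cancel_right _ (inv_mem q.1.2), Subgroup.mul_mem_cancel_left _ q.1.2]
  let e' (P : (ZMod N ⊕ {w : ZMod N // ¬ IsUnit w}) → Prop) :
      {q : borelSubgroup N × (ZMod N ⊕ {w : ZMod N // ¬ IsUnit w}) // P q.2} ≃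
        borelSubgroup N × {l // P l} :=
    { toFun := fun q => (q.1.1, ⟨q.1.2, q.2⟩)
      invFun := fun q => ⟨(q.1, q.2.1), q.2.2⟩
      left_inv := fun _ => rfl
      right_inv := fun _ => rfl }
  rw [conjCount, ← Nat.card_congr (e.subtypeEquiv he),
    Nat.card_congr (e' fun l => ∀ r ∈ S, cosetRep l * r * (cosetRep l)⁻¹ ∈ borelSubgroup N),
    Nat.card_prod, Nat.card_congr Equiv.subtypeSum, Nat.card_sum, mul_comm]
  rfl

/-- The integers `(b, δ, c)` are, modulo `N`, the coefficients of the quadratic form whose zeros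
are the lines stable under the matrix `g`. -/
def IsFormOf {N : ℕ} (t : ℤ × ℤ × ℤ) (g : GL2 N) : Prop :=
  (t.1 : ZMod N) = g.val 0 1 ∧ (t.2.1 : ZMod N) = g.val 1 1 - g.val 0 0 ∧
    (t.2.2 : ZMod N) = g.val 1 0

theorem card_subtype_zmod_eq_ncard {N : ℕ} [NeZero N] {P : ℤ → Prop} {Q : ZMod N → Prop}
    (h : ∀ x : ℤ, Q x ↔ P x) :
    Nat.card {x : ZMod N // Q x} = {x : ℤ | (0 ≤ x ∧ x < (N : ℤ)) ∧ P x}.ncard := by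
  rw [← Nat.card_coe_set_eq]
  refine Nat.card_congr
    { toFun := fun x => ⟨(x.1.val : ℤ), ⟨by positivity, by exact_mod_cast x.1.val_lt⟩, ?_⟩
      invFun := fun x => ⟨(x.1 : ZMod N), (h _).2 x.2.2⟩
      left_inv := fun x => by simp
      right_inv := fun x => ?_ }
  · rw [← h]
    simpa using x.2
  · obtain ⟨x, ⟨h0, h1⟩, hx⟩ := x
    ext
    simp only
    rw [ZMod.val_intCast, Int.emod_eq_of_lt h0 h1]

theorem not_isUnit_intCast_iff {p n : ℕ} (hp : p.Prime) (hn : n ≠ 0) (w : ℤ) :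
    ¬ IsUnit (w : ZMod (p ^ n)) ↔ (p : ℤ) ∣ w := by
  rw [ZMod.coe_int_isUnit_iff_isCoprime, Nat.cast_pow,
    IsCoprime.pow_left_iff (Nat.pos_of_ne_zero hn),
    (Nat.prime_iff_prime_int.1 hp).coprime_iff_not_dvd, not_not]

theorem isLocalRing_zmod_prime_pow {p n : ℕ} (hp : p.Prime) (hn : n ≠ 0) :
    IsLocalRing (ZMod (p ^ n)) := by
  have : Fact (1 < p ^ n) := ⟨Nat.one_lt_pow hn hp.one_lt⟩
  refine IsLocalRing.of_nonunits_add fun a b ha hb => ?_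
  obtain ⟨a, rfl⟩ := ZMod.intCast_surjective a
  obtain ⟨b, rfl⟩ := ZMod.intCast_surjective b
  rw [mem_nonunits_iff, not_isUnit_intCast_iff hp hn] at ha hb
  rw [mem_nonunits_iff, ← Int.cast_add, not_isUnit_intCast_iff hp hn]
  exact dvd_add ha hb

/-- `conjCount` for a group generated by matrices, in terms of their quadratic forms. -/
theorem conjCount_closure_eq_lineCount_mul {p n : ℕ} (hp : p.Prime) (hn : n ≠ 0)
    {S : Set (GL2 (p ^ n))} {M : Set (ℤ × ℤ × ℤ)} (hS : ∀ g ∈ S, ∃ t ∈ M, IsFormOf t g)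
    (hM : ∀ t ∈ M, ∃ g ∈ S, IsFormOf t g) :
    conjCount (B0 (p ^ n)) (Subgroup.closure S) = lineCount p n M * Nat.card (B0 (p ^ n)) := by
  have := isLocalRing_zmod_prime_pow hp hn
  have : NeZero (p ^ n) := ⟨pow_ne_zero _ hp.ne_zero⟩
  rw [conjCount_closure_eq_card_mul, lineCount]
  have hA : ∀ x : ℤ, (∀ r ∈ S, lowerRep (x : ZMod (p ^ n)) * r * (lowerRep (x : ZMod (p ^ n)))⁻¹ ∈
      borelSubgroup (p ^ n)) ↔ ∀ t ∈ M, (p : ℤ) ^ n ∣ t.1 * x ^ 2 + t.2.1 * x - t.2.2 := fun x => by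
    have key : ∀ t r, IsFormOf t r → (lowerRep (x : ZMod (p ^ n)) * r *
        (lowerRep (x : ZMod (p ^ n)))⁻¹ ∈ borelSubgroup (p ^ n) ↔
        (p : ℤ) ^ n ∣ t.1 * x ^ 2 + t.2.1 * x - t.2.2) := fun t r h => by
      rw [lowerRep_conj_mem_borelSubgroup, ← h.1, ← h.2.1, ← h.2.2, ← Nat.cast_pow,
        ← ZMod.intCast_zmod_eq_zero_iff_dvd]
      push_cast
      rfl
    refine ⟨fun h t ht => ?_, fun h r hr => ?_⟩
    · obtain ⟨g, hg, htg⟩ := hM t ht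
      exact (key t g htg).1 (h g hg)
    · obtain ⟨t, ht, htr⟩ := hS r hr
      exact (key t r htr).2 (h t ht)
  have hB : ∀ x : ℤ, (∀ r ∈ S, swapRep (x : ZMod (p ^ n)) * r * (swapRep (x : ZMod (p ^ n)))⁻¹ ∈
      borelSubgroup (p ^ n)) ↔ ∀ t ∈ M, (p : ℤ) ^ n ∣ t.1 + t.2.1 * x - t.2.2 * x ^ 2 := fun x => by
    have key : ∀ t r, IsFormOf t r → (swapRep (x : ZMod (p ^ n)) * r *
        (swapRep (x : ZMod (p ^ n)))⁻¹ ∈ borelSubgroup (p ^ n) ↔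
        (p : ℤ) ^ n ∣ t.1 + t.2.1 * x - t.2.2 * x ^ 2) := fun t r h => by
      rw [swapRep_conj_mem_borelSubgroup, ← h.1, ← h.2.1, ← h.2.2, ← Nat.cast_pow,
        ← ZMod.intCast_zmod_eq_zero_iff_dvd]
      push_cast
      rfl
    refine ⟨fun h t ht => ?_, fun h r hr => ?_⟩
    · obtain ⟨g, hg, htg⟩ := hM t ht
      exact (key t g htg).1 (h g hg)
    · obtain ⟨t, ht, htr⟩ := hS r hr
      exact (key t r htr).2 (h t ht)
  rw [card_subtype_zmod_eq_ncard hA, Nat.card_congr (Equiv.subtypeSubtypeEquivSubtypeInter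
      (fun w : ZMod (p ^ n) => ¬ IsUnit w)
      (fun w => ∀ r ∈ S, swapRep w * r * (swapRep w)⁻¹ ∈ borelSubgroup (p ^ n))),
    card_subtype_zmod_eq_ncard fun x => and_congr (not_isUnit_intCast_iff hp hn x) (hB x)]
  push_cast
  rfl

theorem isFormOf_redGL {p k : ℕ} {t : ℤ × ℤ × ℤ} {g : GL2 (p ^ (k + 1))} (h : IsFormOf t g) :
    IsFormOf t (redGL p k g) := by
  have hval : ∀ i i', (redGL p k g).val i i' =
      ZMod.castHom (pow_dvd_pow p (Nat.le_succ k)) (ZMod (p ^ k)) (g.val i i') := fun _ _ => rfl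
  refine ⟨?_, ?_, ?_⟩
  · rw [hval, ← h.1, map_intCast]
  · rw [hval, hval, ← map_sub, ← h.2.1, map_intCast]
  · rw [hval, ← h.2.2, map_intCast]

theorem conjCount_map_redGL_closure {p k : ℕ} (hp : p.Prime) (hk : k ≠ 0)
    {S : Set (GL2 (p ^ (k + 1)))} {M : Set (ℤ × ℤ × ℤ)} (hS : ∀ g ∈ S, ∃ t ∈ M, IsFormOf t g)
    (hM : ∀ t ∈ M, ∃ g ∈ S, IsFormOf t g) :
    conjCount (B0 (p ^ k)) ((Subgroup.closure S).map (redGL p k)) =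
      lineCount p k M * Nat.card (B0 (p ^ k)) := by
  rw [MonoidHom.map_closure]
  refine conjCount_closure_eq_lineCount_mul hp hk ?_ fun t ht => ?_
  · rintro _ ⟨g, hg, rfl⟩
    obtain ⟨t, ht, h⟩ := hS g hg
    exact ⟨t, ht, isFormOf_redGL h⟩
  · obtain ⟨g, hg, h⟩ := hM t ht
    exact ⟨_, Set.mem_image_of_mem _ hg, isFormOf_redGL h⟩

theorem conjCount_map_conj {N : ℕ} (H : Set (GL2 N)) (R : Subgroup (GL2 N)) (g : GL2 N) :
    conjCount H (R.map (MulAut.conj g).toMonoidHom) = conjCount H R := by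
  refine Nat.card_congr ((Equiv.mulRight g).subtypeEquiv fun h => ?_)
  simp [Subgroup.mem_map, mul_assoc]

theorem map_redGL_map_conj {p k : ℕ} (R : Subgroup (GL2 (p ^ (k + 1)))) (g : GL2 (p ^ (k + 1))) :
    (R.map (MulAut.conj g).toMonoidHom).map (redGL p k) =
      (R.map (redGL p k)).map (MulAut.conj (redGL p k g)).toMonoidHom := by
  rw [Subgroup.map_map, Subgroup.map_map]
  congr 1
  ext1 r
  simp

theorem card_B0_pos (N : ℕ) [NeZero N] : 0 < Nat.card (B0 N) :=
  Nat.card_pos_iff.2 ⟨⟨⟨1, (borelSubgroup N).one_mem⟩⟩, inferInstance⟩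

theorem eq_of_conjCount_eq {p k j m : ℕ} (hp : p.Prime) (hodd : Odd p) (hk : 0 < k) (hj : j < k)
    {R : Subgroup (GL2 (p ^ (k + 1)))}
    (h : conjCount (B0 (p ^ k)) (R.map (redGL p k)) = p ^ j * Nat.card (B0 (p ^ k)))
    (hm : conjCount (B0 (p ^ (k + 1))) R = m * Nat.card (B0 (p ^ (k + 1)))) :
    m = 0 ∨ m = p ^ j ∨ (k ≤ 2 * j + 1 ∧ m = p ^ (j + 1)) ∨ (k ≤ 2 * j ∧ m = 2 * p ^ j) := by
  have : NeZero p := ⟨hp.ne_zero⟩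
  rcases Nat.eq_zero_or_pos m with hm0 | hm0
  · exact Or.inl hm0
  right
  have hpos : 0 < conjCount (B0 (p ^ (k + 1))) R := hm ▸ Nat.mul_pos hm0 (card_B0_pos _)
  obtain ⟨⟨⟨g, hg⟩⟩, -⟩ := Nat.card_pos_iff.1 hpos
  rw [← conjCount_map_conj _ _ g] at hm
  rw [← conjCount_map_conj _ _ (redGL p k g), ← map_redGL_map_conj] at h
  have hB : ∀ r ∈ R.map (MulAut.conj g).toMonoidHom, r ∈ B0 (p ^ (k + 1)) := by
    rintro _ ⟨r, hr, rfl⟩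
    exact hg r hr
  generalize R.map (MulAut.conj g).toMonoidHom = R' at h hm hB
  have hS : ∀ r ∈ (R' : Set (GL2 (p ^ (k + 1)))),
      ∃ t ∈ {t : ℤ × ℤ × ℤ | t.2.2 = 0 ∧ ∃ r ∈ R', IsFormOf t r}, IsFormOf t r := fun r hr => by
    have hform : IsFormOf (((r.val 0 1).val : ℤ), ((r.val 1 1 - r.val 0 0).val : ℤ), (0 : ℤ)) r :=
      ⟨by simp, by simp, by simpa using (hB r hr).symm⟩
    exact ⟨_, ⟨rfl, r, hr, hform⟩, hform⟩
  have hM : ∀ t ∈ {t : ℤ × ℤ × ℤ | t.2.2 = 0 ∧ ∃ r ∈ R', IsFormOf t r},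
      ∃ r ∈ (R' : Set (GL2 (p ^ (k + 1)))), IsFormOf t r := fun t ht => ht.2
  have e1 := conjCount_closure_eq_lineCount_mul hp k.succ_ne_zero hS hM
  have e2 := conjCount_map_redGL_closure hp hk.ne' hS hM
  rw [Subgroup.closure_eq] at e1 e2
  have e1' := Nat.eq_of_mul_eq_mul_right (card_B0_pos _) (hm.symm.trans e1)
  have e2' := Nat.eq_of_mul_eq_mul_right (card_B0_pos _) (h.symm.trans e2)
  rw [e1']
  exact lineCount_succ_mem hp hodd hj (fun t ht => ht.1) e2'.symm

theorem exists_subgroup_of_forms {p k : ℕ} (hp : p.Prime) (hk : 0 < k) {M : Set (ℤ × ℤ × ℤ)}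
    (hM : ∀ t ∈ M, ∃ g : GL2 (p ^ (k + 1)), IsFormOf t g) :
    ∃ R : Subgroup (GL2 (p ^ (k + 1))),
      conjCount (B0 (p ^ k)) (R.map (redGL p k)) = lineCount p k M * Nat.card (B0 (p ^ k)) ∧
      conjCount (B0 (p ^ (k + 1))) R = lineCount p (k + 1) M * Nat.card (B0 (p ^ (k + 1))) := by
  have hS : ∀ g ∈ {g : GL2 (p ^ (k + 1)) | ∃ t ∈ M, IsFormOf t g}, ∃ t ∈ M, IsFormOf t g :=
    fun g hg => hg
  have hM' : ∀ t ∈ M, ∃ g ∈ {g : GL2 (p ^ (k + 1)) | ∃ t ∈ M, IsFormOf t g}, IsFormOf t g :=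
    fun t ht => (hM t ht).imp fun g hg => ⟨⟨t, ht, hg⟩, hg⟩
  exact ⟨_, conjCount_map_redGL_closure hp hk.ne' hS hM',
    conjCount_closure_eq_lineCount_mul hp k.succ_ne_zero hS hM'⟩

theorem exists_isFormOf_upper {p n : ℕ} (hp : p.Prime) (hn : n ≠ 0) (b δ : ℤ)
    (hδ : ¬ (p : ℤ) ∣ 1 + δ) : ∃ g : GL2 (p ^ n), IsFormOf (b, δ, 0) g := by
  have hu : IsUnit ((1 + δ : ℤ) : ZMod (p ^ n)) := by
    by_contra h
    exact hδ ((not_isUnit_intCast_iff hp hn _).1 h)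
  refine ⟨Matrix.GeneralLinearGroup.mk'' !![1, (b : ZMod (p ^ n)); 0, ((1 + δ : ℤ) : ZMod (p ^ n))]
    (by simpa [Matrix.det_fin_two] using hu), ?_, ?_, ?_⟩ <;>
  simp [Matrix.GeneralLinearGroup.mk'', Matrix.nonsingInvUnit]

theorem isFormOf_lowerRep {N : ℕ} (c : ℤ) : IsFormOf (0, 0, c) (lowerRep (c : ZMod N)) := by
  refine ⟨?_, ?_, ?_⟩ <;> simp [lowerRep]

theorem ncard_snd_lines_eq_zero {p n : ℕ} {M : Set (ℤ × ℤ × ℤ)} {t : ℤ × ℤ × ℤ} (ht : t ∈ M)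
    (h : ∀ w : ℤ, (p : ℤ) ∣ w → ¬ (p : ℤ) ^ n ∣ t.1 + t.2.1 * w - t.2.2 * w ^ 2) :
    {w : ℤ | (0 ≤ w ∧ w < (p : ℤ) ^ n) ∧ (p : ℤ) ∣ w ∧
      ∀ t ∈ M, (p : ℤ) ^ n ∣ t.1 + t.2.1 * w - t.2.2 * w ^ 2}.ncard = 0 := by
  have : {w : ℤ | (0 ≤ w ∧ w < (p : ℤ) ^ n) ∧ (p : ℤ) ∣ w ∧
      ∀ t ∈ M, (p : ℤ) ^ n ∣ t.1 + t.2.1 * w - t.2.2 * w ^ 2} = ∅ :=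
    Set.eq_empty_of_forall_notMem fun w hw => h w hw.2.1 (hw.2.2 t ht)
  rw [this, Set.ncard_empty]

theorem natCast_pow_dvd_pow_iff {p : ℕ} (hp : p.Prime) (a b : ℕ) :
    (p : ℤ) ^ a ∣ (p : ℤ) ^ b ↔ a ≤ b :=
  pow_dvd_pow_iff (by exact_mod_cast hp.ne_zero) (Nat.prime_iff_prime_int.1 hp).not_isUnit

theorem lineCount_pair {p n j : ℕ} (hp : p.Prime) (hj : j < n) {M : Set (ℤ × ℤ × ℤ)}
    (h1 : ((p : ℤ) ^ j, 0, 0) ∈ M) (h2 : (0, (p : ℤ) ^ j, 0) ∈ M)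
    (hM : ∀ t ∈ M, t = ((p : ℤ) ^ j, 0, 0) ∨ t = (0, (p : ℤ) ^ j, 0) ∨
      (t.1 = 0 ∧ t.2.1 = 0 ∧ (p : ℤ) ^ n ∣ t.2.2)) :
    lineCount p n M = p ^ j := by
  have hp0 : (p : ℤ) ≠ 0 := by exact_mod_cast hp.ne_zero
  have hsplit : (p : ℤ) ^ n = (p : ℤ) ^ j * (p : ℤ) ^ (n - j) := by
    rw [← pow_add]; congr 1; omega
  rw [lineCount, ncard_snd_lines_eq_zero h1, add_zero,
    ncard_eq_of_iff_residue_class hp (Nat.sub_le n j) 0, Nat.sub_sub_self hj.le]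
  · intro x
    rw [sub_zero]
    refine ⟨fun h => ?_, fun h t ht => ?_⟩
    · have := h _ h2
      rw [zero_mul, zero_add, sub_zero, hsplit] at this
      exact (mul_dvd_mul_iff_left (pow_ne_zero j hp0)).1 this
    · rcases hM t ht with rfl | rfl | ⟨h0, h0', h3⟩
      · rw [zero_mul, add_zero, sub_zero, hsplit, pow_two]
        exact mul_dvd_mul_left _ (h.mul_right x)
      · rw [zero_mul, zero_add, sub_zero, hsplit]
        exact mul_dvd_mul_left _ h
      · rw [h0, h0', zero_mul, zero_mul, zero_add, zero_sub]
        exact h3.neg_right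
  · intro w _ h
    rw [zero_mul, zero_mul, add_zero, sub_zero, natCast_pow_dvd_pow_iff hp] at h
    omega

theorem lineCount_eq_zero {p k j : ℕ} (hp : p.Prime) (hj : j < k) {M : Set (ℤ × ℤ × ℤ)}
    (h1 : ((p : ℤ) ^ j, 0, 0) ∈ M) (h2 : (0, 0, (p : ℤ) ^ k) ∈ M) :
    lineCount p (k + 1) M = 0 := by
  rw [lineCount, ncard_snd_lines_eq_zero h1, add_zero, Set.ncard_eq_zero
    ((Set.finite_Ico (0 : ℤ) ((p : ℤ) ^ (k + 1))).subset fun w hw => hw.1)]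
  · refine Set.eq_empty_of_forall_notMem ?_
    rintro x ⟨-, h⟩
    have := h _ h2
    rw [zero_mul, zero_mul, zero_add, zero_sub, dvd_neg, natCast_pow_dvd_pow_iff hp] at this
    omega
  · intro w _ h
    rw [zero_mul, zero_mul, add_zero, sub_zero, natCast_pow_dvd_pow_iff hp] at h
    omega

theorem lineCount_singleton {p n d : ℕ} (hp : p.Prime) (hd : d < n) (m : ℤ) :
    lineCount p n {((p : ℤ) ^ d, (p : ℤ) ^ d * m, 0)} =
      {x : ℤ | (0 ≤ x ∧ x < (p : ℤ) ^ n) ∧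
        ((p : ℤ) ^ (n - d) ∣ x * (x + m) ∧ (p : ℤ) ^ (n - d - (n - d)) ∣ x)}.ncard := by
  have hp0 : (p : ℤ) ≠ 0 := by exact_mod_cast hp.ne_zero
  have hsplit : (p : ℤ) ^ n = (p : ℤ) ^ d * (p : ℤ) ^ (n - d) := by
    rw [← pow_add]; congr 1; omega
  rw [lineCount, ncard_snd_lines_eq_zero (Set.mem_singleton _), add_zero]
  · congr 1
    ext x
    simp only [Set.mem_singleton_iff, forall_eq, Set.mem_ofPred_eq, Nat.sub_self, pow_zero,
      one_dvd, and_true, sub_zero]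
    rw [show (p : ℤ) ^ d * x ^ 2 + (p : ℤ) ^ d * m * x = (p : ℤ) ^ d * (x * (x + m)) by ring,
      hsplit, mul_dvd_mul_iff_left (pow_ne_zero d hp0)]
  · intro w hw h
    rw [zero_mul, sub_zero, mul_assoc] at h
    have h' := (pow_dvd_pow (p : ℤ) hd).trans h
    rw [dvd_add_left, natCast_pow_dvd_pow_iff hp] at h'
    · omega
    · rw [pow_succ]
      exact mul_dvd_mul_left _ (hw.mul_left m)

theorem not_dvd_one_add_pow {p : ℕ} (hp : p.Prime) (hodd : Odd p) (j : ℕ) :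
    ¬ (p : ℤ) ∣ 1 + (p : ℤ) ^ j := by
  intro h
  cases j with
  | zero =>
    have h2 : p ∣ 2 := by exact_mod_cast h
    rw [(Nat.prime_dvd_prime_iff_eq hp Nat.prime_two).1 h2] at hodd
    exact absurd hodd (by decide)
  | succ j =>
    refine (Nat.prime_iff_prime_int.1 hp).not_dvd_one ?_
    exact (dvd_add_left (dvd_pow_self _ j.succ_ne_zero)).1 h

theorem not_dvd_one_add_zero {p : ℕ} (hp : p.Prime) : ¬ (p : ℤ) ∣ 1 + 0 := by
  rw [add_zero]
  exact (Nat.prime_iff_prime_int.1 hp).not_dvd_one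

theorem isogeny_count_lift_from_pj
    (p k j : ℕ) (hp : p.Prime) (hodd : Odd p) (hk : 0 < k) (hj : j < k)
    (T : Set ℕ)
    (hT : T = {m | ∃ R : Subgroup (GL2 (p ^ (k + 1))),
      conjCount (B0 (p ^ k)) (R.map (redGL p k)) =
        p ^ j * Nat.card (B0 (p ^ k)) ∧
      conjCount (B0 (p ^ (k + 1))) R = m * Nat.card (B0 (p ^ (k + 1)))}) :
    (2 * j < k - 1 → T = {0, p ^ j}) ∧
    (2 * j = k - 1 → T = {0, p ^ j, p ^ (j + 1)}) ∧
    (k ≤ 2 * j → T = {0, p ^ j, p ^ (j + 1), 2 * p ^ j}) := by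
  have hk' : k + 1 ≠ 0 := k.succ_ne_zero
  have hupper : ∀ m ∈ T, m = 0 ∨ m = p ^ j ∨ (k ≤ 2 * j + 1 ∧ m = p ^ (j + 1)) ∨
      (k ≤ 2 * j ∧ m = 2 * p ^ j) := by
    subst hT
    rintro m ⟨R, h, hm⟩
    exact eq_of_conjCount_eq hp hodd hk hj h hm
  have hmem : ∀ M : Set (ℤ × ℤ × ℤ), (∀ t ∈ M, ∃ g : GL2 (p ^ (k + 1)), IsFormOf t g) →
      lineCount p k M = p ^ j → lineCount p (k + 1) M ∈ T := by
    intro M hM hMk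
    obtain ⟨R, h, hm⟩ := exists_subgroup_of_forms hp hk hM
    rw [hT]
    exact ⟨R, hMk ▸ h, hm⟩
  have hu1 := exists_isFormOf_upper hp hk' ((p : ℤ) ^ j) 0 (not_dvd_one_add_zero hp)
  have hu2 := exists_isFormOf_upper hp hk' 0 ((p : ℤ) ^ j) (not_dvd_one_add_pow hp hodd j)
  have hT0 : 0 ∈ T := by
    have h := hmem {((p : ℤ) ^ j, 0, 0), (0, (p : ℤ) ^ j, 0), (0, 0, (p : ℤ) ^ k)} ?_ ?_
    · rwa [lineCount_eq_zero hp hj (by simp) (by simp)] at h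
    · rintro t (rfl | rfl | rfl)
      exacts [hu1, hu2, ⟨_, isFormOf_lowerRep _⟩]
    · refine lineCount_pair hp hj (by simp) (by simp) ?_
      rintro t (rfl | rfl | rfl) <;> simp
  have hT1 : p ^ j ∈ T := by
    have hpair : ∀ n, j < n →
        lineCount p n {((p : ℤ) ^ j, 0, 0), (0, (p : ℤ) ^ j, 0)} = p ^ j := fun n hn => by
      refine lineCount_pair hp hn (by simp) (by simp) ?_
      rintro t (rfl | rfl) <;> simp
    have h := hmem {((p : ℤ) ^ j, 0, 0), (0, (p : ℤ) ^ j, 0)} ?_ (hpair k hj)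
    · rwa [hpair (k + 1) (by omega)] at h
    · rintro t (rfl | rfl)
      exacts [hu1, hu2]
  have hT2 : k ≤ 2 * j + 1 → p ^ (j + 1) ∈ T := by
    intro hkj
    have h := hmem {((p : ℤ) ^ (2 * j + 1 - k), (p : ℤ) ^ (2 * j + 1 - k) * 0, 0)} ?_ ?_
    · rw [lineCount_singleton hp (by omega),
        ncard_roots_of_le hp (dvd_zero ((p : ℤ) ^ (k + 1))) (by omega) (by omega)] at h
      convert h using 2
      omega
    · rintro t rfl
      exact exists_isFormOf_upper hp hk' _ _ (by simpa using not_dvd_one_add_zero hp)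
    · rw [lineCount_singleton hp (by omega),
        ncard_roots_of_le hp (dvd_zero ((p : ℤ) ^ (k + 1))) (by omega) (by omega)]
      congr 1
      omega
  have hT3 : k ≤ 2 * j → 2 * p ^ j ∈ T := by
    intro hkj
    have hdvd : ¬ (p : ℤ) ^ (k - j + 1) ∣ (p : ℤ) ^ (k - j) := by
      rw [natCast_pow_dvd_pow_iff hp]
      omega
    have h := hmem {((p : ℤ) ^ (2 * j - k), (p : ℤ) ^ (2 * j - k) * (p : ℤ) ^ (k - j), 0)} ?_ ?_
    · rw [lineCount_singleton hp (by omega),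
        ncard_roots_of_lt_of_le hp dvd_rfl hdvd (by omega) (by omega) (by omega)] at h
      convert h using 3
      omega
    · rintro t rfl
      refine exists_isFormOf_upper hp hk' _ _ ?_
      rw [← pow_add]
      exact not_dvd_one_add_pow hp hodd _
    · rw [lineCount_singleton hp (by omega),
        ncard_roots_of_le hp (dvd_refl ((p : ℤ) ^ (k - j))) (by omega) (by omega)]
      congr 1
      omega
  refine ⟨fun h => ?_, fun h => ?_, fun h => ?_⟩
  · refine Set.Subset.antisymm (fun m hm => ?_) ?_
    · rcases hupper m hm with h0 | h1 | ⟨h2, -⟩ | ⟨h3, -⟩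
      · simp [h0]
      · simp [h1]
      · omega
      · omega
    · rintro m (rfl | rfl)
      exacts [hT0, hT1]
  · refine Set.Subset.antisymm (fun m hm => ?_) ?_
    · rcases hupper m hm with h0 | h1 | ⟨-, h2⟩ | ⟨h3, -⟩
      · simp [h0]
      · simp [h1]
      · simp [h2]
      · omega
    · rintro m (rfl | rfl | rfl)
      exacts [hT0, hT1, hT2 (by omega)]
  · refine Set.Subset.antisymm (fun m hm => ?_) ?_
    · rcases hupper m hm with h0 | h1 | ⟨-, h2⟩ | ⟨-, h3⟩
      · simp [h0]
      · simp [h1]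
      · simp [h2]
      · simp [h3]
    · rintro m (rfl | rfl | rfl | rfl)
      exacts [hT0, hT1, hT2 (by omega), hT3 h]
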